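/- Let (W,S) be the Coxeter system of type A₃, i.e. S = {s₁, s₂, s₃} with s_i² = e, (s₁s₂)³ = (s₂s₃)³ = e, (s₁s₃)² = e, and let * = id. Suppose η : 𝕄 → M is a K-linear bijection with η(X_∅) = a_e and η(ρ_s(v)) = T_s(η(v)) for all s ∈ S and v ∈ 𝕄. Then η⁻¹(a_{s₁s₃}) = (u−1)²·(u⁻² δ_{s₁s₃} + u⁻³ δ_{s₁s₃s₂} + u⁻⁴ δ_{s₁s₃s₂s₁} + u⁻⁴ δ_{s₁s₃s₂s₃} + u⁻⁵ δ_{s₁s₃s₂s₁s₃} + u⁻⁶ δ_{s₁s₂s₁s₃s₂s₁}). -/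

import Mathlib

open Finsupp

noncomputable section

/-- `K = ℚ(u)`, the field of rational functions in `u` over `ℚ`. -/
abbrev K : Type := RatFunc ℚ

/-- The indeterminate `u`. -/
noncomputable def u : K := RatFunc.X

variable {B W : Type*} [Group W] {Mat : CoxeterMatrix B}

/-- `ρ_s : V → V`, left multiplication by the standard generator `T_s` of the
Iwahori–Hecke algebra of `W` in its standard basis `(δ_x)_{x ∈ W}`:
`ρ_s δ_x = δ_{sx}` if `l(sx) > l(x)`, and
`ρ_s δ_x = (u²−1) δ_x + u² δ_{sx}` if `l(sx) < l(x)`. -/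
noncomputable def rho (cs : CoxeterSystem Mat W) (s : W) : (W →₀ K) →ₗ[K] (W →₀ K) :=
  Finsupp.lsum K fun x => LinearMap.toSpanSingleton K (W →₀ K)
    (if cs.length (s * x) > cs.length x then Finsupp.single (s * x) 1
     else (u ^ 2 - 1) • Finsupp.single x (1 : K) + (u ^ 2 : K) • Finsupp.single (s * x) 1)

/-- `X_∅ = Σ_{x ∈ W, x* = x} u^{−l(x)} δ_x`. -/
noncomputable def Xempty [Fintype W] [DecidableEq W] (cs : CoxeterSystem Mat W)
    (star : W ≃* W) : W →₀ K :=
  ∑ x : W, if star x = x then (u ^ (-(cs.length x : ℤ))) • Finsupp.single x (1 : K) else 0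

/-- `𝕄`, the smallest `K`-subspace of `V` containing `X_∅` and stable under `ρ_s`
for all `s ∈ S`. -/
noncomputable def MM [Fintype W] [DecidableEq W] (cs : CoxeterSystem Mat W)
    (star : W ≃* W) : Submodule K (W →₀ K) :=
  sInf {p : Submodule K (W →₀ K) | Xempty cs star ∈ p ∧
    ∀ (i : B) (v : W →₀ K), v ∈ p → rho cs (cs.simple i) v ∈ p}

theorem Xempty_mem_MM [Fintype W] [DecidableEq W] (cs : CoxeterSystem Mat W)
    (star : W ≃* W) : Xempty cs star ∈ MM cs star :=
  Submodule.mem_sInf.2 fun _ hp => hp.1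

theorem rho_mem_MM [Fintype W] [DecidableEq W] (cs : CoxeterSystem Mat W) (star : W ≃* W)
    (i : B) (v : W →₀ K) (hv : v ∈ MM cs star) : rho cs (cs.simple i) v ∈ MM cs star :=
  Submodule.mem_sInf.2 fun p hp => hp.2 i v (Submodule.mem_sInf.1 hv p hp)

/-- `I_* = {w ∈ W : w* = w⁻¹}`. -/
def Istar (star : W ≃* W) : Set W := {w : W | star w = w⁻¹}

theorem one_mem_Istar (star : W ≃* W) : (1 : W) ∈ Istar star := by
  simp [Istar]

/-- `M`, the free `K`-module with basis `(a_w)_{w ∈ I_*}`; the basis element `a_w` is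
`Finsupp.single w 1`. -/
abbrev InvolM (star : W ≃* W) : Type _ := ↥(Istar star) →₀ K

/-- The assertion that the `K`-linear map `T : M → M` is the map `T_s` (for `s` the simple
reflection of index `i`) defined by:
`T_s a_w = u a_w + (u+1) a_{sw}` if `sw = w s*` and `l(sw) > l(w)`;
`T_s a_w = (u²−u−1) a_w + (u²−u) a_{sw}` if `sw = w s*` and `l(sw) < l(w)`;
`T_s a_w = a_{s w s*}` if `sw ≠ w s*` and `l(sw) > l(w)`;
`T_s a_w = (u²−1) a_w + u² a_{s w s*}` if `sw ≠ w s*` and `l(sw) < l(w)`. -/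
def IsTs (cs : CoxeterSystem Mat W) (star : W ≃* W) (i : B)
    (T : InvolM star →ₗ[K] InvolM star) : Prop :=
  ∀ w : ↥(Istar star),
    (∀ w' : ↥(Istar star), (w' : W) = cs.simple i * (w : W) →
      cs.simple i * (w : W) = (w : W) * star (cs.simple i) →
      (cs.length (cs.simple i * (w : W)) > cs.length (w : W) →
        T (single w 1) = u • single w 1 + (u + 1) • single w' 1) ∧
      (cs.length (cs.simple i * (w : W)) < cs.length (w : W) →
        T (single w 1) = (u ^ 2 - u - 1) • single w 1 + (u ^ 2 - u) • single w' 1)) ∧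
    (∀ w' : ↥(Istar star), (w' : W) = cs.simple i * (w : W) * star (cs.simple i) →
      cs.simple i * (w : W) ≠ (w : W) * star (cs.simple i) →
      (cs.length (cs.simple i * (w : W)) > cs.length (w : W) →
        T (single w 1) = single w' 1) ∧
      (cs.length (cs.simple i * (w : W)) < cs.length (w : W) →
        T (single w 1) = (u ^ 2 - 1) • single w 1 + (u ^ 2 : K) • single w' 1))

/-- The defining property of `η : 𝕄 → M`: `η` is a `K`-linear bijection with
`η(X_∅) = a_e` and `η(ρ_s(v)) = T_s(η(v))` for all `s ∈ S` and `v ∈ 𝕄`. -/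
def IsEta [Fintype W] [DecidableEq W] (cs : CoxeterSystem Mat W) (star : W ≃* W)
    (Ts : B → InvolM star →ₗ[K] InvolM star)
    (η : ↥(MM cs star) →ₗ[K] InvolM star) : Prop :=
  Function.Bijective η ∧
  η ⟨Xempty cs star, Xempty_mem_MM cs star⟩ = single ⟨1, one_mem_Istar star⟩ 1 ∧
  ∀ (i : B) (v : ↥(MM cs star)),
    η ⟨rho cs (cs.simple i) (v : W →₀ K), rho_mem_MM cs star i (v : W →₀ K) v.2⟩
      = Ts i (η v)


theorem s13_mem_Istar {W' : Type*} [Group W'] (cs : CoxeterSystem (CoxeterMatrix.Aₙ 3) W') :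
    cs.simple 0 * cs.simple 2 ∈ Istar (MulEquiv.refl W') := by
  have h : (cs.simple 0 * cs.simple 2) ^ 2 = 1 := by
    have h1 := cs.simple_mul_simple_pow 0 2
    have h2 : (CoxeterMatrix.Aₙ 3) 0 2 = 2 := by decide
    rwa [h2] at h1
  show (MulEquiv.refl W') _ = _
  simp only [MulEquiv.refl_apply]
  exact (inv_eq_of_mul_eq_one_right (by rw [← sq]; exact h)).symm

/-- The element `(u−1)²·(u⁻² δ_{s₁s₃} + u⁻³ δ_{s₁s₃s₂} + u⁻⁴ δ_{s₁s₃s₂s₁} + u⁻⁴ δ_{s₁s₃s₂s₃}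
+ u⁻⁵ δ_{s₁s₃s₂s₁s₃} + u⁻⁶ δ_{s₁s₂s₁s₃s₂s₁})` in type `A₃` (here `s₁ = simple 0`,
`s₂ = simple 1`, `s₃ = simple 2`). -/
noncomputable def X13A3 {W' : Type*} [Group W']
    (cs : CoxeterSystem (CoxeterMatrix.Aₙ 3) W') : W' →₀ K :=
  ((u - 1) ^ 2) •
    ((u ^ (-2 : ℤ)) • Finsupp.single (cs.simple 0 * cs.simple 2) (1 : K)
    + (u ^ (-3 : ℤ)) • Finsupp.single (cs.simple 0 * cs.simple 2 * cs.simple 1) (1 : K)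
    + (u ^ (-4 : ℤ)) •
        Finsupp.single (cs.simple 0 * cs.simple 2 * cs.simple 1 * cs.simple 0) (1 : K)
    + (u ^ (-4 : ℤ)) •
        Finsupp.single (cs.simple 0 * cs.simple 2 * cs.simple 1 * cs.simple 2) (1 : K)
    + (u ^ (-5 : ℤ)) •
        Finsupp.single
          (cs.simple 0 * cs.simple 2 * cs.simple 1 * cs.simple 0 * cs.simple 2) (1 : K)
    + (u ^ (-6 : ℤ)) •
        Finsupp.single
          (cs.simple 0 * cs.simple 1 * cs.simple 0 * cs.simple 2 * cs.simple 1 * cs.simple 0)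
          (1 : K))

theorem u_ne_zero : u ≠ 0 := RatFunc.X_ne_zero

theorem u_add_one_ne_zero : u + 1 ≠ 0 := by
  intro h
  have h' : algebraMap (Polynomial ℚ) (RatFunc ℚ) (Polynomial.X + Polynomial.C 1) = 0 := by
    simpa [u] using h
  rw [map_eq_zero_iff _ (RatFunc.algebraMap_injective ℚ)] at h'
  exact (Polynomial.monic_X_add_C (1 : ℚ)).ne_zero h'

theorem rho_simple_apply (cs : CoxeterSystem Mat W) (i : B) (v : W →₀ K) (y : W) :
    rho cs (cs.simple i) v y =
      if cs.length (cs.simple i * y) < cs.length y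
      then v (cs.simple i * y) + (u ^ 2 - 1) * v y
      else u ^ 2 * v (cs.simple i * y) := by
  classical
  induction v using Finsupp.induction_linear with
  | zero => simp
  | add f g hf hg =>
    rw [map_add, Finsupp.add_apply, hf, hg]
    split_ifs <;> simp only [Finsupp.add_apply] <;> ring
  | single x c =>
    have hne := cs.length_simple_mul_ne x i
    have hss : cs.simple i * (cs.simple i * x) = x := cs.simple_mul_simple_cancel_left i
    have hsx : cs.simple i * x ≠ x := fun h => hne (by rw [h])
    simp only [rho, Finsupp.lsum_single, LinearMap.toSpanSingleton_apply]
    by_cases hy : y = x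
    · subst hy
      split_ifs with h1 h2 h2
      · omega
      · simp [hsx, hsx.symm]
      · simp [hsx, hsx.symm]; ring
      · omega
    · by_cases hy' : y = cs.simple i * x
      · subst hy'
        rw [hss]
        split_ifs
        · simp [hsx.symm]
        · simp [hsx.symm]; ring
      · have hy'' : x ≠ cs.simple i * y := fun h => hy' (by
          rw [h, cs.simple_mul_simple_cancel_left])
        split_ifs <;> simp [Ne.symm hy, Ne.symm hy', hy'']

/-- The sum of `u^{−l(x)} δ_x` over all `x` in a finite set. -/
def weightSum (cs : CoxeterSystem Mat W) (A : Finset W) : W →₀ K :=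
  ∑ x ∈ A, (u ^ (-(cs.length x : ℤ))) • Finsupp.single x (1 : K)

theorem weightSum_apply [DecidableEq W] (cs : CoxeterSystem Mat W) (A : Finset W) (y : W) :
    weightSum cs A y = if y ∈ A then u ^ (-(cs.length y : ℤ)) else 0 := by
  simp [weightSum, Finsupp.finsetSum_apply, Finsupp.single_apply]

open Classical in
theorem rho_weightSum (cs : CoxeterSystem Mat W) (i : B) (A : Finset W)
    (hA : ∀ x, cs.simple i * x ∈ A ↔ x ∈ A) :
    rho cs (cs.simple i) (weightSum cs A) =
      u • weightSum cs A + (u ^ 2 - 1) • weightSum cs {x ∈ A | cs.IsLeftDescent x i} := by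
  have hu := u_ne_zero
  ext y
  rw [rho_simple_apply]
  simp only [Finsupp.add_apply, Finsupp.smul_apply, weightSum_apply, hA, Finset.mem_filter,
    smul_eq_mul]
  simp only [CoxeterSystem.IsLeftDescent]
  by_cases hy : y ∈ A
  · rcases cs.length_simple_mul y i with h | h
    · have h' : ¬ cs.length (cs.simple i * y) < cs.length y := by omega
      simp only [hy, h', if_true, if_false, and_false]
      rw [h]
      push_cast
      rw [neg_add, zpow_add₀ hu, zpow_neg_one]
      field_simp
      ring
    · have h' : cs.length (cs.simple i * y) < cs.length y := by omega
      simp only [hy, h', if_true, and_true]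
      rw [← h]
      push_cast
      rw [neg_add, zpow_add₀ hu, zpow_neg_one]
      field_simp
  · simp [hy]

/-- The number of inversions of a permutation of `Fin 4`. -/
def inversions (σ : Equiv.Perm (Fin 4)) : ℕ :=
  (Finset.univ.filter fun p : Fin 4 × Fin 4 => p.1 < p.2 ∧ σ p.2 < σ p.1).card

/-- The adjacent transpositions of `Fin 4`. -/
def adjSwap (i : Fin 3) : Equiv.Perm (Fin 4) := Equiv.swap i.castSucc i.succ

theorem isLiftable_adjSwap : (CoxeterMatrix.Aₙ 3).IsLiftable adjSwap := by
  unfold CoxeterMatrix.IsLiftable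
  decide +kernel

theorem inversions_mul_adjSwap_le :
    ∀ (σ : Equiv.Perm (Fin 4)) (i : Fin 3), inversions (σ * adjSwap i) ≤ inversions σ + 1 := by
  decide +kernel

theorem inversions_prod_le (ω : List (Fin 3)) :
    inversions (ω.map adjSwap).prod ≤ ω.length := by
  induction ω using List.reverseRecOn with
  | nil => decide +kernel
  | append_singleton ω i ih =>
    simp only [List.map_append, List.prod_append, List.length_append, List.map_singleton,
      List.prod_singleton, List.length_singleton]
    exact (inversions_mul_adjSwap_le _ i).trans (by omega)

/-- The homomorphism from the Coxeter group of type `A₃` to the symmetric group. -/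
def toPerm (cs : CoxeterSystem (CoxeterMatrix.Aₙ 3) W) : W →* Equiv.Perm (Fin 4) :=
  cs.lift ⟨adjSwap, isLiftable_adjSwap⟩

theorem toPerm_wordProd (cs : CoxeterSystem (CoxeterMatrix.Aₙ 3) W) (ω : List (Fin 3)) :
    toPerm cs (cs.wordProd ω) = (ω.map adjSwap).prod := by
  rw [CoxeterSystem.wordProd, map_list_prod, List.map_map]
  congr 2
  ext1 i
  exact cs.lift_apply_simple isLiftable_adjSwap i

theorem length_wordProd_of_inversions (cs : CoxeterSystem (CoxeterMatrix.Aₙ 3) W)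
    (ω : List (Fin 3)) (h : inversions (ω.map adjSwap).prod = ω.length) :
    cs.length (cs.wordProd ω) = ω.length := by
  refine le_antisymm (cs.length_wordProd_le ω) ?_
  obtain ⟨τ, hτ, hω⟩ := cs.exists_isReduced (cs.wordProd ω)
  have h1 := inversions_prod_le τ
  rw [← toPerm_wordProd cs, ← hω, toPerm_wordProd, h] at h1
  rw [hω, hτ.eq]
  exact h1

/-- Reduced words of the minimal length representatives of the right cosets of `⟨s₁, s₃⟩`. -/
def repWord : Fin 6 → List (Fin 3) := ![[], [1], [1, 0], [1, 2], [1, 0, 2], [1, 0, 2, 1]]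

/-- The word `s₁ᵐ s₃ⁿ` followed by the `k`-th coset representative. -/
def cosetWord (m n : Fin 2) (k : Fin 6) : List (Fin 3) :=
  List.replicate m 0 ++ (List.replicate n 2 ++ repWord k)

theorem length_cosetWord (cs : CoxeterSystem (CoxeterMatrix.Aₙ 3) W) (m n : Fin 2) (k : Fin 6) :
    cs.length (cs.wordProd (cosetWord m n k)) = m + n + (repWord k).length := by
  rw [length_wordProd_of_inversions cs]
  · simp [cosetWord, add_assoc]
  · revert m n k
    decide +kernel

section relations

variable (cs : CoxeterSystem (CoxeterMatrix.Aₙ 3) W)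

theorem simple_two_mul_simple_zero :
    cs.simple 2 * cs.simple 0 = cs.simple 0 * cs.simple 2 := by
  have h : (cs.simple 0 * cs.simple 2) ^ 2 = 1 := cs.simple_mul_simple_pow 0 2
  rw [sq] at h
  simpa using (inv_eq_of_mul_eq_one_right h)

theorem braid_zero_one :
    cs.simple 1 * (cs.simple 0 * cs.simple 1) = cs.simple 0 * (cs.simple 1 * cs.simple 0) := by
  have h : (cs.simple 0 * cs.simple 1) ^ 3 = 1 := cs.simple_mul_simple_pow 0 1
  have h' : (cs.simple 0 * (cs.simple 1 * cs.simple 0)) *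
      (cs.simple 1 * (cs.simple 0 * cs.simple 1)) = 1 := by
    rw [← h]; simp only [pow_succ, pow_zero, one_mul, mul_assoc]
  simpa [mul_assoc] using (inv_eq_of_mul_eq_one_right h').symm

theorem braid_two_one :
    cs.simple 1 * (cs.simple 2 * cs.simple 1) = cs.simple 2 * (cs.simple 1 * cs.simple 2) := by
  have h : (cs.simple 2 * cs.simple 1) ^ 3 = 1 := cs.simple_mul_simple_pow 2 1
  have h' : (cs.simple 2 * (cs.simple 1 * cs.simple 2)) *
      (cs.simple 1 * (cs.simple 2 * cs.simple 1)) = 1 := by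
    rw [← h]; simp only [pow_succ, pow_zero, one_mul, mul_assoc]
  simpa [mul_assoc] using (inv_eq_of_mul_eq_one_right h').symm

theorem simple_zero_mul_cosetWord (m n : Fin 2) (k : Fin 6) :
    cs.simple 0 * cs.wordProd (cosetWord m n k) = cs.wordProd (cosetWord (1 - m) n k) := by
  fin_cases m <;> simp [cosetWord, cs.wordProd_append, cs.wordProd_cons]

theorem simple_two_mul_cosetWord (m n : Fin 2) (k : Fin 6) :
    cs.simple 2 * cs.wordProd (cosetWord m n k) = cs.wordProd (cosetWord m (1 - n) k) := by
  have h (w : W) : cs.simple 2 * (cs.simple 0 * w) = cs.simple 0 * (cs.simple 2 * w) := by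
    rw [← mul_assoc, simple_two_mul_simple_zero, mul_assoc]
  fin_cases m <;> fin_cases n <;>
    simp [cosetWord, cs.wordProd_cons, h]

theorem repWord_mul_simple (k : Fin 6) (i : Fin 3) :
    ∃ m n k', cs.wordProd (repWord k) * cs.simple i = cs.wordProd (cosetWord m n k') := by
  have hc := simple_two_mul_simple_zero cs
  have hc' (w : W) : cs.simple 2 * (cs.simple 0 * w) = cs.simple 0 * (cs.simple 2 * w) := by
    rw [← mul_assoc, hc, mul_assoc]
  have h1 := braid_zero_one cs
  have h2 := braid_two_one cs
  have h1' (w : W) : cs.simple 1 * (cs.simple 0 * (cs.simple 1 * w)) =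
      cs.simple 0 * (cs.simple 1 * (cs.simple 0 * w)) := by
    simpa [mul_assoc] using congrArg (· * w) h1
  have h2' (w : W) : cs.simple 1 * (cs.simple 2 * (cs.simple 1 * w)) =
      cs.simple 2 * (cs.simple 1 * (cs.simple 2 * w)) := by
    simpa [mul_assoc] using congrArg (· * w) h2
  have key : cs.wordProd (repWord k) * cs.simple i = cs.wordProd (repWord k ++ [i]) := by
    rw [cs.wordProd_append, cs.wordProd_singleton]
  rw [key]
  fin_cases k <;> fin_cases i
  · exact ⟨1, 0, 0, by simp [repWord, cosetWord]⟩
  · exact ⟨0, 0, 1, by simp [repWord, cosetWord]⟩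
  · exact ⟨0, 1, 0, by simp [repWord, cosetWord]⟩
  · exact ⟨0, 0, 2, by simp [repWord, cosetWord]⟩
  · exact ⟨0, 0, 0, by simp [repWord, cosetWord, cs.wordProd_cons]⟩
  · exact ⟨0, 0, 3, by simp [repWord, cosetWord]⟩
  · exact ⟨0, 0, 1, by simp [repWord, cosetWord, cs.wordProd_cons]⟩
  · exact ⟨1, 0, 2, by simp [repWord, cosetWord, cs.wordProd_cons, h1]⟩
  · exact ⟨0, 0, 4, by simp [repWord, cosetWord]⟩
  · exact ⟨0, 0, 4, by simp [repWord, cosetWord, cs.wordProd_cons, hc]⟩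
  · exact ⟨0, 1, 3, by simp [repWord, cosetWord, cs.wordProd_cons, h2]⟩
  · exact ⟨0, 0, 1, by simp [repWord, cosetWord, cs.wordProd_cons]⟩
  · exact ⟨0, 0, 3, by simp [repWord, cosetWord, cs.wordProd_cons, hc]⟩
  · exact ⟨0, 0, 5, by simp [repWord, cosetWord]⟩
  · exact ⟨0, 0, 2, by simp [repWord, cosetWord, cs.wordProd_cons]⟩
  · refine ⟨0, 1, 5, ?_⟩
    simp only [repWord, cosetWord, cs.wordProd_append]
    simp [cs.wordProd_cons, mul_assoc]
    rw [← hc', ← h1, h2', hc']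
  · exact ⟨0, 0, 4, by simp [repWord, cosetWord, cs.wordProd_cons]⟩
  · refine ⟨1, 0, 5, ?_⟩
    simp only [repWord, cosetWord, cs.wordProd_append]
    simp [cs.wordProd_cons, mul_assoc]
    rw [← h2, h1']

theorem exists_eq_cosetWord (x : W) : ∃ m n k, x = cs.wordProd (cosetWord m n k) := by
  induction x using cs.simple_induction_right with
  | one => exact ⟨0, 0, 0, by simp [cosetWord, repWord]⟩
  | mul_simple_right x i ih =>
    obtain ⟨m, n, k, rfl⟩ := ih
    obtain ⟨m', n', k', h⟩ := repWord_mul_simple cs k i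
    have e : cs.wordProd (cosetWord m n k) * cs.simple i =
        cs.simple 0 ^ (m : ℕ) * (cs.simple 2 ^ (n : ℕ) * cs.wordProd (cosetWord m' n' k')) := by
      rw [← h]
      simp [cosetWord, CoxeterSystem.wordProd, mul_assoc]
    rw [e]
    fin_cases m <;> fin_cases n
    · exact ⟨m', n', k', by simp⟩
    · exact ⟨m', 1 - n', k', by simp [simple_two_mul_cosetWord]⟩
    · exact ⟨1 - m', n', k', by simp [simple_zero_mul_cosetWord]⟩
    · exact ⟨1 - m', 1 - n', k', by simp [simple_zero_mul_cosetWord, simple_two_mul_cosetWord]⟩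

theorem isLeftDescent_zero_cosetWord (m n : Fin 2) (k : Fin 6) :
    cs.IsLeftDescent (cs.wordProd (cosetWord m n k)) 0 ↔ m = 1 := by
  rw [CoxeterSystem.IsLeftDescent, simple_zero_mul_cosetWord, length_cosetWord, length_cosetWord]
  fin_cases m <;> simp

theorem isLeftDescent_two_cosetWord (m n : Fin 2) (k : Fin 6) :
    cs.IsLeftDescent (cs.wordProd (cosetWord m n k)) 2 ↔ n = 1 := by
  rw [CoxeterSystem.IsLeftDescent, simple_two_mul_cosetWord, length_cosetWord, length_cosetWord]
  fin_cases n <;> simp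

theorem isLeftDescent_zero_simple_two_mul (x : W) :
    cs.IsLeftDescent (cs.simple 2 * x) 0 ↔ cs.IsLeftDescent x 0 := by
  obtain ⟨m, n, k, rfl⟩ := exists_eq_cosetWord cs x
  rw [simple_two_mul_cosetWord, isLeftDescent_zero_cosetWord, isLeftDescent_zero_cosetWord]

theorem cosetWord_injective :
    Function.Injective fun k => cs.wordProd (cosetWord 1 1 k) := by
  intro k k' h
  have h' := congrArg (toPerm cs) h
  simp only [toPerm_wordProd] at h'
  revert k k'
  have : ∀ k k' : Fin 6, ((cosetWord 1 1 k).map adjSwap).prod =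
    ((cosetWord 1 1 k').map adjSwap).prod → k = k' := by decide +kernel
  exact fun k k' _ h => this k k' h

open Classical in
theorem weightSum_descents_eq [Fintype W] :
    (u - 1) ^ 2 • weightSum cs {x ∈ ({x | cs.IsLeftDescent x 0} : Finset W) |
      cs.IsLeftDescent x 2} = X13A3 cs := by
  have hset : ({x ∈ ({x | cs.IsLeftDescent x 0} : Finset W) | cs.IsLeftDescent x 2} : Finset W) =
      Finset.univ.map ⟨_, cosetWord_injective cs⟩ := by
    ext x
    simp only [Finset.mem_filter, Finset.mem_univ, true_and, Finset.mem_map,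
      Function.Embedding.coeFn_mk]
    constructor
    · rintro ⟨h0, h2⟩
      obtain ⟨m, n, k, rfl⟩ := exists_eq_cosetWord cs x
      rw [isLeftDescent_zero_cosetWord] at h0
      rw [isLeftDescent_two_cosetWord] at h2
      exact ⟨k, by rw [h0, h2]⟩
    · rintro ⟨k, rfl⟩
      exact ⟨(isLeftDescent_zero_cosetWord cs _ _ _).2 rfl,
        (isLeftDescent_two_cosetWord cs _ _ _).2 rfl⟩
  have hw : cs.simple 0 * cs.simple 1 * cs.simple 0 * cs.simple 2 * cs.simple 1 * cs.simple 0 =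
      cs.wordProd (cosetWord 1 1 5) := by
    have hc := simple_two_mul_simple_zero cs
    have h2 (w : W) : cs.simple 1 * (cs.simple 2 * (cs.simple 1 * w)) =
        cs.simple 2 * (cs.simple 1 * (cs.simple 2 * w)) := by
      simpa [mul_assoc] using congrArg (· * w) (braid_two_one cs)
    have hc' (w : W) : cs.simple 2 * (cs.simple 0 * w) = cs.simple 0 * (cs.simple 2 * w) := by
      rw [← mul_assoc, hc, mul_assoc]
    simp only [repWord, cosetWord, cs.wordProd_append]
    simp [cs.wordProd_cons, mul_assoc]
    rw [← hc', ← braid_zero_one, h2, hc']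
  rw [hset, weightSum, Finset.sum_map, X13A3, hw]
  simp only [Function.Embedding.coeFn_mk, length_cosetWord, Fin.sum_univ_six]
  simp [cosetWord, repWord, cs.wordProd_cons, mul_assoc]

end relations

/-- for the Coxeter system of type `A₃` (matrix `CoxeterMatrix.Aₙ 3`) with
`* = id`, if `η : 𝕄 → M` is a `K`-linear bijection with `η(X_∅) = a_e` and
`η(ρ_s(v)) = T_s(η(v))` for all `s ∈ S`, `v ∈ 𝕄`, then
`η⁻¹(a_{s₁s₃}) = (u−1)²·(u⁻² δ_{s₁s₃} + u⁻³ δ_{s₁s₃s₂} + u⁻⁴ δ_{s₁s₃s₂s₁}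
+ u⁻⁴ δ_{s₁s₃s₂s₃} + u⁻⁵ δ_{s₁s₃s₂s₁s₃} + u⁻⁶ δ_{s₁s₂s₁s₃s₂s₁})`. -/
theorem statement13 {W : Type*} [Group W] [Fintype W] [DecidableEq W]
    (cs : CoxeterSystem (CoxeterMatrix.Aₙ 3) W)
    (Ts : Fin 3 → InvolM (MulEquiv.refl W) →ₗ[K] InvolM (MulEquiv.refl W))
    (hTs : ∀ i, IsTs cs (MulEquiv.refl W) i (Ts i))
    (η : ↥(MM cs (MulEquiv.refl W)) →ₗ[K] InvolM (MulEquiv.refl W))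
    (hη : IsEta cs (MulEquiv.refl W) Ts η) :
    ∃ h13 : X13A3 cs ∈ MM cs (MulEquiv.refl W),
      η ⟨X13A3 cs, h13⟩
        = single ⟨cs.simple 0 * cs.simple 2, s13_mem_Istar cs⟩ 1 := by
  classical
  have hu := u_add_one_ne_zero
  obtain ⟨-, hX, hη⟩ := hη
  have hs : cs.simple 0 ∈ Istar (MulEquiv.refl W) := by simp [Istar]
  have hXe : Xempty cs (MulEquiv.refl W) = weightSum cs Finset.univ := by
    simp [Xempty, weightSum]
  set D : Finset W := {x | cs.IsLeftDescent x 0} with hD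
  set v₁ := weightSum cs D with hv₁
  have h₁ : rho cs (cs.simple 0) (Xempty cs (MulEquiv.refl W)) =
      u • Xempty cs (MulEquiv.refl W) + (u ^ 2 - 1) • v₁ := by
    rw [hXe, rho_weightSum cs 0 _ (by simp)]
  have h₂ : rho cs (cs.simple 2) ((u ^ 2 - 1) • v₁) =
      u • ((u ^ 2 - 1) • v₁) + (u + 1) ^ 2 • X13A3 cs := by
    rw [map_smul, rho_weightSum cs 2 D (by simp [hD, isLeftDescent_zero_simple_two_mul]),
      ← weightSum_descents_eq, smul_add, smul_comm u, smul_smul (u ^ 2 - 1) (u ^ 2 - 1),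
      smul_smul ((u + 1) ^ 2)]
    congr 2
    ring
  have hlen : cs.length (cs.simple 2 * cs.simple 0) = 2 := by
    simpa [cosetWord, repWord, cs.wordProd_cons, simple_two_mul_simple_zero] using
      length_cosetWord cs 1 1 0
  have hT₁ : Ts 0 (single ⟨1, one_mem_Istar _⟩ 1) =
      u • single ⟨1, one_mem_Istar _⟩ 1 + (u + 1) • single ⟨cs.simple 0, hs⟩ 1 :=
    ((hTs 0 ⟨1, one_mem_Istar _⟩).1 ⟨cs.simple 0, hs⟩ (by simp) (by simp)).1 (by simp)
  have hT₂ : Ts 2 (single ⟨cs.simple 0, hs⟩ 1) = u • single ⟨cs.simple 0, hs⟩ 1 +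
      (u + 1) • single ⟨cs.simple 0 * cs.simple 2, s13_mem_Istar cs⟩ 1 :=
    ((hTs 2 ⟨cs.simple 0, hs⟩).1 ⟨cs.simple 0 * cs.simple 2, s13_mem_Istar cs⟩
      (simple_two_mul_simple_zero cs).symm (simple_two_mul_simple_zero cs)).1 (by simp [hlen])
  have hX₀ := Xempty_mem_MM cs (MulEquiv.refl W)
  have m₁ : (u ^ 2 - 1) • v₁ ∈ MM cs (MulEquiv.refl W) := by
    rw [← add_sub_cancel_left (u • Xempty cs (MulEquiv.refl W)) ((u ^ 2 - 1) • v₁), ← h₁]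
    exact sub_mem (rho_mem_MM _ _ _ _ hX₀) (Submodule.smul_mem _ _ hX₀)
  have m₂ : (u + 1) ^ 2 • X13A3 cs ∈ MM cs (MulEquiv.refl W) := by
    rw [← add_sub_cancel_left (u • (u ^ 2 - 1) • v₁) ((u + 1) ^ 2 • X13A3 cs), ← h₂]
    exact sub_mem (rho_mem_MM _ _ _ _ m₁) (Submodule.smul_mem _ _ m₁)
  have m₃ : X13A3 cs ∈ MM cs (MulEquiv.refl W) :=
    (Submodule.smul_mem_iff _ (pow_ne_zero 2 hu)).1 m₂
  refine ⟨m₃, ?_⟩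
  have e₁ := hη 0 ⟨_, hX₀⟩
  have f₁ : (⟨_, rho_mem_MM cs _ 0 _ hX₀⟩ : MM cs (MulEquiv.refl W)) =
      u • ⟨_, hX₀⟩ + ⟨_, m₁⟩ := Subtype.ext h₁
  rw [f₁, map_add, map_smul, hX, hT₁] at e₁
  have e₁' := add_left_cancel e₁
  have e₂ := hη 2 ⟨_, m₁⟩
  have f₂ : (⟨_, rho_mem_MM cs _ 2 _ m₁⟩ : MM cs (MulEquiv.refl W)) =
      u • ⟨_, m₁⟩ + (u + 1) ^ 2 • ⟨_, m₃⟩ := Subtype.ext h₂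
  rw [f₂, map_add, map_smul, map_smul, e₁', map_smul, hT₂, smul_add, smul_comm u (u + 1)] at e₂
  have e₂' := add_left_cancel e₂
  rw [smul_smul, ← sq] at e₂'
  exact smul_right_injective _ (pow_ne_zero 2 hu) e₂'

end
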